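/- arXiv:1111.3933 — 9 statements merged into one kernel-verified Lean document; each statement's English description precedes it below -/
import Mathlib

section
/- Let G be a simple congestion game with player set N and resource set R, and let C be a partition of N in which every block has size at most 2. Then the coalitional congestion game G^C induced by G and C possesses a pure Nash equilibrium. -/
open Finset

/-- The congestion of resource `r` at profile `s`: the number of players choosing `r`. -/
def congestion {N R : Type*} [Fintype N] [DecidableEq R] (s : N → R) (r : R) : ℕ :=
  (univ.filter fun i => s i = r).card

/-- The payment of player `i` at profile `s` in the simple congestion game with costs `P`. -/
def pay {N R : Type*} [Fintype N] [DecidableEq R] (P : R → ℕ → ℝ) (s : N → R) (i : N) : ℝ :=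
  P (s i) (congestion s (s i))

/-- The total payment of the coalition `b` at profile `s`. -/
def coalPay {N R : Type*} [Fintype N] [DecidableEq R] (P : R → ℕ → ℝ) (s : N → R)
    (b : Finset N) : ℝ :=
  ∑ i ∈ b, pay P s i

/-- The profile obtained from `s` when the coalition `b` deviates to `t`. -/
def deviate {N R : Type*} [DecidableEq N] (s t : N → R) (b : Finset N) : N → R :=
  fun i => if i ∈ b then t i else s i

/-- `s` is a pure Nash equilibrium of the coalitional congestion game `G^C`:
no coalition (block of `C`) can strictly decrease its total payment by simultaneously
changing the resources chosen by its members. -/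
def IsCCGNE {N R : Type*} [Fintype N] [DecidableEq N] [DecidableEq R]
    (P : R → ℕ → ℝ) (C : Finpartition (univ : Finset N)) (s : N → R) : Prop :=
  ∀ b ∈ C.parts, ∀ t : N → R, coalPay P s b ≤ coalPay P (deviate s t b) b


lemma aux_congr_update {N R : Type*} [Fintype N] [DecidableEq N] [DecidableEq R]
    (s : N → R) (j : N) (d x : R) :
    congestion (Function.update s j d) x + (if s j = x then 1 else 0)
      = congestion s x + (if d = x then 1 else 0) := by
  unfold congestion
  rw [card_filter, card_filter, ← Finset.add_sum_erase _ _ (mem_univ j),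
    ← Finset.add_sum_erase univ (fun i => if s i = x then 1 else 0) (mem_univ j)]
  have : ∑ i ∈ univ.erase j, (if Function.update s j d i = x then 1 else 0)
      = ∑ i ∈ univ.erase j, (if s i = x then 1 else 0) := by
    apply Finset.sum_congr rfl
    intro i hi
    rw [Function.update_of_ne (Finset.ne_of_mem_erase hi)]
  rw [this]
  simp only [Function.update_self]
  omega

lemma aux_congr_pos {N R : Type*} [Fintype N] [DecidableEq R]
    (s : N → R) (j : N) : 1 ≤ congestion s (s j) := by
  unfold congestion
  exact Finset.card_pos.mpr ⟨j, by simp⟩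

lemma aux_congr_le {N R : Type*} [Fintype N] [DecidableEq R]
    (s : N → R) (x : R) : congestion s x ≤ Fintype.card N := by
  unfold congestion
  exact Finset.card_le_univ _

def AuxNash {N R : Type*} [Fintype N] [DecidableEq R] (P : R → ℕ → ℝ) (s : N → R) : Prop :=
  ∀ k d, d ≠ s k → P (s k) (congestion s (s k)) ≤ P d (congestion s d + 1)

lemma aux_exists_nash {N R : Type*} [Fintype N] [DecidableEq N] [Fintype R] [DecidableEq R]
    [Nonempty R] (P : R → ℕ → ℝ) : ∃ s : N → R, AuxNash P s := by
  obtain ⟨s, hs⟩ := Finite.exists_min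
    (fun s : N → R => ∑ r, ∑ k ∈ range (congestion s r), P r (k + 1))
  refine ⟨s, fun k d hd => ?_⟩
  have h := hs (Function.update s k d)
  have hc := aux_congr_update s k d
  set s' := Function.update s k d
  have hpos := aux_congr_pos s k
  rw [← Finset.add_sum_erase _ _ (mem_univ d),
    ← Finset.add_sum_erase univ (fun r => ∑ k ∈ range (congestion s' r), P r (k + 1)) (mem_univ d),
    ← Finset.add_sum_erase (univ.erase d) _ (mem_erase.2 ⟨hd.symm, mem_univ (s k)⟩),
    ← Finset.add_sum_erase (univ.erase d) (fun r => ∑ k ∈ range (congestion s' r), P r (k + 1))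
      (mem_erase.2 ⟨hd.symm, mem_univ (s k)⟩)] at h
  have e : ∑ r ∈ (univ.erase d).erase (s k), ∑ k ∈ range (congestion s' r), P r (k + 1)
      = ∑ r ∈ (univ.erase d).erase (s k), ∑ k ∈ range (congestion s r), P r (k + 1) := by
    apply Finset.sum_congr rfl
    intro r hr
    simp only [mem_erase] at hr
    have := hc r
    rw [if_neg (Ne.symm hr.1), if_neg (Ne.symm hr.2.1)] at this
    simp only [add_zero] at this
    rw [this]
  have h1 : congestion s' d = congestion s d + 1 := by
    have := hc d
    simpa [hd.symm] using this
  have h2 : congestion s (s k) = congestion s' (s k) + 1 := by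
    have := hc (s k)
    simpa [hd] using this.symm
  rw [e, h1, h2, Finset.sum_range_succ, Finset.sum_range_succ] at h
  rw [h2]
  linarith

lemma aux_single {N R : Type*} [Fintype N] [DecidableEq N] [DecidableEq R]
    (P : R → ℕ → ℝ) (s : N → R) (i : N)
    (h : ∀ d, d ≠ s i → P (s i) (congestion s (s i)) ≤ P d (congestion s d + 1)) (t : N → R) :
    coalPay P s {i} ≤ coalPay P (deviate s t {i}) {i} := by
  have hd : deviate s t {i} = Function.update s i (t i) := by
    funext k
    by_cases hk : k = i
    · subst hk; simp [deviate]
    · simp [deviate, hk]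
  rw [hd]
  simp only [coalPay, sum_singleton, pay, Function.update_self]
  have hc := aux_congr_update s i (t i) (t i)
  by_cases hx : t i = s i
  · rw [hx]; simp
  · rw [if_neg (Ne.symm hx), if_pos rfl, add_zero] at hc
    rw [hc]
    exact h _ hx

lemma aux_pair {N R : Type*} [Fintype N] [DecidableEq N] [DecidableEq R]
    (P : R → ℕ → ℝ) (s : N → R) (i j : N) (hij : i ≠ j)
    (h : ∀ (x y : R) (c' : R → ℕ),
      (∀ z, c' z + (if s i = z then 1 else 0) + (if s j = z then 1 else 0)
        = congestion s z + (if x = z then 1 else 0) + (if y = z then 1 else 0)) →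
      P (s i) (congestion s (s i)) + P (s j) (congestion s (s j)) ≤ P x (c' x) + P y (c' y))
    (t : N → R) :
    coalPay P s {i, j} ≤ coalPay P (deviate s t {i, j}) {i, j} := by
  have hd : deviate s t {i, j} = Function.update (Function.update s i (t i)) j (t j) := by
    funext k
    by_cases hk : k = j
    · subst hk; simp [deviate]
    · by_cases hk' : k = i
      · subst hk'; simp [deviate, hk]
      · simp [deviate, hk, hk']
  rw [hd]
  simp only [coalPay, sum_pair hij, pay, Function.update_self, Function.update_of_ne hij]
  apply h
  intro z
  have h1 := aux_congr_update s i (t i) z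
  have h2 := aux_congr_update (Function.update s i (t i)) j (t j) z
  rw [Function.update_of_ne hij.symm] at h2
  omega

/-- numeric lemma, split pair in Nash -/
lemma aux_num_split {R : Type*} [DecidableEq R] (P : R → ℕ → ℝ) (hP : ∀ r, Monotone (P r))
    (c c' : R → ℕ) (u v x y : R) (huv : u ≠ v)
    (hu : ∀ d, d ≠ u → P u (c u) ≤ P d (c d + 1))
    (hv : ∀ d, d ≠ u → P v (c v) ≤ P d (c d + 1))
    (h4 : P u (c u) + P v (c v) ≤ 2 * P u (c u + 1))
    (hc : ∀ z, c' z + (if u = z then 1 else 0) + (if v = z then 1 else 0)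
        = c z + (if x = z then 1 else 0) + (if y = z then 1 else 0)) :
    P u (c u) + P v (c v) ≤ P x (c' x) + P y (c' y) := by
  have hx := hc x
  have hy := hc y
  have m1 := fun r k => hP r (Nat.le_succ k)
  have a1 := m1 x (c x)
  have a2 := m1 x (c x + 1)
  have a3 := hu x
  have a4 := hv x
  have a5 := hu y
  have a6 := hv y
  simp only [if_true] at hx hy
  by_cases e1 : x = u
  · subst e1
    by_cases e2 : y = x
    · subst e2
      have : c' y = c y + 1 := by simpa [huv.symm] using hx
      rw [this]; linarith
    · have e : c' x = c x := by simpa [huv.symm, e2] using hx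
      rw [e]
      by_cases e3 : y = v
      · subst e3
        have : c' y = c y := by simpa [e2, Ne.symm e2] using hy
        rw [this]
      · have : c' y = c y + 1 := by simpa [Ne.symm e2, Ne.symm e3] using hy
        rw [this]; linarith [a6 e2]
  · have a3 := a3 e1
    have a4 := a4 e1
    by_cases e2 : y = u
    · subst e2
      have e : c' y = c y := by simpa [huv.symm, e1] using hy
      rw [e]
      by_cases e3 : x = v
      · subst e3
        have : c' x = c x := by simpa [e1, Ne.symm e1] using hx
        rw [this]; linarith
      · have : c' x = c x + 1 := by simpa [Ne.symm e1, Ne.symm e3] using hx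
        rw [this]; linarith
    · have a5 := a5 e2
      have a6 := a6 e2
      by_cases e3 : x = v
      · subst e3
        by_cases e4 : y = x
        · subst e4
          have : c' y = c y + 1 := by simpa [huv] using hx
          rw [this]; linarith
        · have e : c' x = c x := by simpa [huv, e4] using hx
          have e' : c' y = c y + 1 := by simpa [Ne.symm e2, Ne.symm e4] using hy
          rw [e, e']; linarith
      · by_cases e4 : y = v
        · subst e4
          have e : c' y = c y := by simpa [huv, e3] using hy
          have e' : c' x = c x + 1 := by simpa [Ne.symm e1, Ne.symm e3] using hx
          rw [e, e']; linarith
        · have e' : P x (c x + 1) ≤ P x (c' x) := hP x (by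
            simp only [if_neg (Ne.symm e1), if_neg (Ne.symm e3)] at hx; omega)
          have e : P y (c y + 1) ≤ P y (c' y) := hP y (by
            simp only [if_neg (Ne.symm e2), if_neg (Ne.symm e4)] at hy; omega)
          linarith

lemma aux_num_tog {R : Type*} [DecidableEq R] (P : R → ℕ → ℝ) (hP : ∀ r, Monotone (P r))
    (c c' : R → ℕ) (u x y : R)
    (hu : ∀ d, d ≠ u → P u (c u) ≤ P d (c d + 1))
    (hs : ∀ d, d ≠ u → 2 * P u (c u) ≤ P u (c u - 1) + P d (c d + 1))
    (hc : ∀ z, c' z + (if u = z then 1 else 0) + (if u = z then 1 else 0)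
        = c z + (if x = z then 1 else 0) + (if y = z then 1 else 0)) :
    P u (c u) + P u (c u) ≤ P x (c' x) + P y (c' y) := by
  have hx := hc x
  have hy := hc y
  have a3 := hu x
  have a5 := hu y
  simp only [if_true] at hx hy
  by_cases e1 : x = u
  · subst e1
    by_cases e2 : y = x
    · subst e2
      have : c' y = c y := by simp at hx; omega
      rw [this]
    · have e : c' x = c x - 1 := by simp [e2] at hx; omega
      have e' : c' y = c y + 1 := by simpa [Ne.symm e2] using hy
      rw [e, e']; linarith [hs y e2]
  · by_cases e2 : y = u
    · subst e2
      have e : c' y = c y - 1 := by simp [e1] at hy; omega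
      have e' : c' x = c x + 1 := by simpa [Ne.symm e1] using hx
      rw [e, e']; linarith [hs x e1]
    · have e' : P x (c x + 1) ≤ P x (c' x) := hP x (by
        simp only [if_neg (Ne.symm e1)] at hx; omega)
      have e : P y (c y + 1) ≤ P y (c' y) := hP y (by
        simp only [if_neg (Ne.symm e2)] at hy; omega)
      linarith [a3 e1, a5 e2]

def AuxTog {N R : Type*} (s : N → R) (b : Finset N) : Prop :=
  ∃ i ∈ b, ∃ j ∈ b, i ≠ j ∧ s i = s j

lemma aux_congr_swap {N R : Type*} [Fintype N] [DecidableEq R]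
    (s : N → R) (σ : Equiv.Perm N) (x : R) : congestion (s ∘ σ) x = congestion s x := by
  unfold congestion
  apply Finset.card_bij (fun i _ => σ i)
  · intro i hi; simpa using hi
  · intro i _ j _ h; exact σ.injective h
  · intro i hi
    exact ⟨σ.symm i, by simpa using hi, by simp⟩

lemma aux_nash_swap {N R : Type*} [Fintype N] [DecidableEq R] (P : R → ℕ → ℝ)
    (s : N → R) (σ : Equiv.Perm N) (h : AuxNash P s) : AuxNash P (s ∘ σ) := by
  intro k d hd
  rw [aux_congr_swap, aux_congr_swap]
  exact h (σ k) d hd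

lemma aux_two {N : Type*} [DecidableEq N] {b : Finset N} (hb : b.card ≤ 2) {i j k : N}
    (hi : i ∈ b) (hj : j ∈ b) (hij : i ≠ j) (hk : k ∈ b) : k = i ∨ k = j := by
  by_contra! h
  have : ({k, i, j} : Finset N) ⊆ b := by
    intro x hx
    simp only [mem_insert, mem_singleton] at hx
    rcases hx with rfl | rfl | rfl <;> assumption
  have h2 := Finset.card_le_card this
  rw [Finset.card_eq_three.2 ⟨k, i, j, h.1, h.2, hij, rfl⟩] at h2
  omega

/-- Phase 1 -/
lemma aux_phase1 {N R : Type*} [Fintype N] [DecidableEq N] [Fintype R] [DecidableEq R]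
    [Nonempty R] (P : R → ℕ → ℝ) (C : Finpartition (univ : Finset N))
    (hsize : ∀ b ∈ C.parts, b.card ≤ 2) :
    ∃ s : N → R, AuxNash P s ∧ ((∀ b ∈ C.parts, ¬ AuxTog s b) ∨
      ∃ a, ∀ b ∈ C.parts, ∃ i ∈ b, s i = a) := by
  classical
  obtain ⟨s, hs, hmin⟩ := WellFounded.has_min
    (measure (fun s : N → R => (C.parts.filter (AuxTog s)).card)).wf
    {s | AuxNash P s} (aux_exists_nash P)
  refine ⟨s, hs, ?_⟩
  by_contra! hcon
  obtain ⟨⟨b, hb, i, hi, j, hj, hij, hsij⟩, h2⟩ := hcon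
  obtain ⟨b', hb', hna⟩ := h2 (s j)
  obtain ⟨k, hk⟩ := C.nonempty_of_mem_parts hb'
  have hbb : b ≠ b' := by
    rintro rfl; exact hna j hj rfl
  have hdis : ∀ x, x ∈ b → x ∈ b' → False := fun x h1 h2 =>
    hbb (C.eq_of_mem_parts hb hb' h1 h2)
  apply hmin (s ∘ Equiv.swap j k) (aux_nash_swap P s _ hs)
  show Finset.card _ < Finset.card _
  apply Finset.card_lt_card
  have hik : i ≠ k := fun h => hdis k (h ▸ hi) hk
  have hnb : ¬ AuxTog (s ∘ Equiv.swap j k) b := by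
    rintro ⟨p, hp, q, hq, hpq, he⟩
    simp only [Function.comp] at he
    have e1 : s (Equiv.swap j k i) = s j := by
      rw [Equiv.swap_apply_of_ne_of_ne hij hik, hsij]
    have e2 : s (Equiv.swap j k j) = s k := by rw [Equiv.swap_apply_left]
    rcases aux_two (hsize b hb) hi hj hij hp with rfl | rfl <;>
    rcases aux_two (hsize b hb) hi hj hij hq with rfl | rfl
    · exact hpq rfl
    · rw [e1, e2] at he; exact hna k hk he.symm
    · rw [e1, e2] at he; exact hna k hk he
    · exact hpq rfl
  rw [Finset.ssubset_iff_of_subset]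
  · exact ⟨b, by simp only [mem_filter]; exact ⟨hb, i, hi, j, hj, hij, hsij⟩, by simp [hnb]⟩
  · intro c hc
    simp only [mem_filter] at hc ⊢
    obtain ⟨hc, p, hp, q, hq, hpq, he⟩ := hc
    have hcb : c ≠ b := by
      rintro rfl; exact hnb ⟨p, hp, q, hq, hpq, he⟩
    have hjc : j ∉ c := fun h => hcb (C.eq_of_mem_parts hc hb h hj)
    have hpj : p ≠ j := fun h => hjc (h ▸ hp)
    have hqj : q ≠ j := fun h => hjc (h ▸ hq)
    simp only [Function.comp] at he
    refine ⟨hc, p, hp, q, hq, hpq, ?_⟩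
    by_cases hpk : p = k
    · subst hpk
      have := C.eq_of_mem_parts hc hb' hp hk
      subst this
      rw [Equiv.swap_apply_right, Equiv.swap_apply_of_ne_of_ne hqj hpq.symm] at he
      exact absurd he.symm (hna q hq)
    · by_cases hqk : q = k
      · subst hqk
        have := C.eq_of_mem_parts hc hb' hq hk
        subst this
        rw [Equiv.swap_apply_right, Equiv.swap_apply_of_ne_of_ne hpj hpq] at he
        exact absurd he (hna p hp)
      · rwa [Equiv.swap_apply_of_ne_of_ne hpj hpk, Equiv.swap_apply_of_ne_of_ne hqj hqk] at he

lemma aux_block {N : Type*} [DecidableEq N] {b : Finset N} (hb : b.card ≤ 2) {i : N}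
    (hi : i ∈ b) : b = {i} ∨ ∃ j, i ≠ j ∧ b = {i, j} := by
  by_cases h : ∃ j ∈ b, i ≠ j
  · obtain ⟨j, hj, hij⟩ := h
    right
    refine ⟨j, hij, ?_⟩
    ext k
    simp only [mem_insert, mem_singleton]
    constructor
    · exact aux_two hb hi hj hij
    · rintro (rfl | rfl) <;> assumption
  · push Not at h
    left
    ext k
    simp only [mem_singleton]
    exact ⟨fun hk => (h k hk).symm, fun hk => hk ▸ hi⟩

def AuxInv {N R : Type*} [Fintype N] [DecidableEq N] [DecidableEq R] (P : R → ℕ → ℝ)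
    (C : Finpartition (univ : Finset N)) (a : R) (s : N → R) : Prop :=
  (∀ b ∈ C.parts, ∃ i ∈ b, s i = a) ∧
  (∀ k d, s k ≠ a → d ≠ a → P (s k) (congestion s (s k)) ≤ P d (congestion s d + 1)) ∧
  (∀ d, d ≠ a → P a (congestion s a) ≤ P d (congestion s d + 1)) ∧
  (∀ k, s k ≠ a → P a (congestion s a) + P (s k) (congestion s (s k))
    ≤ 2 * P a (congestion s a + 1))

lemma aux_phase2 {N R : Type*} [Fintype N] [DecidableEq N] [Fintype R] [DecidableEq R]
    (P : R → ℕ → ℝ) (hP : ∀ r, Monotone (P r)) (C : Finpartition (univ : Finset N))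
    (hsize : ∀ b ∈ C.parts, b.card ≤ 2) (a : R) (s₀ : N → R) (hs₀ : AuxInv P C a s₀) :
    ∃ s : N → R, IsCCGNE P C s := by
  classical
  obtain ⟨s, hs, hmin⟩ := WellFounded.has_min
    (measure (fun s : N → R => congestion s a)).wf {s | AuxInv P C a s} ⟨s₀, hs₀⟩
  obtain ⟨h1, h2, h3, h4⟩ := hs
  refine ⟨s, fun b hb t => ?_⟩
  obtain ⟨i, hi, hia⟩ := h1 b hb
  rcases aux_block (hsize b hb) hi with rfl | ⟨j, hij, rfl⟩
  · apply aux_single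
    rw [hia]; exact h3
  apply aux_pair _ _ _ _ hij
  intro x y c' hc
  rw [hia] at hc ⊢
  by_cases hja : s j = a
  swap
  · exact aux_num_split P hP _ c' a (s j) x y (Ne.symm hja) h3 (fun d hd => h2 j d hja hd)
      (h4 j hja) hc
  rw [hja] at hc ⊢
  apply aux_num_tog P hP _ c' a x y h3 _ hc
  by_contra! hcon
  obtain ⟨d₀, hd₀, hlt₀⟩ := hcon
  obtain ⟨d, hd, hdmin⟩ := Finset.exists_min_image (univ.erase a)
    (fun d => P d (congestion s d + 1)) ⟨d₀, by simp [hd₀]⟩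
  have hda : d ≠ a := by simpa using hd
  have hlt : P a (congestion s a - 1) + P d (congestion s d + 1) < 2 * P a (congestion s a) := by
    have := hdmin d₀ (by simp [hd₀])
    linarith
  have hdmin' : ∀ e, e ≠ a → P d (congestion s d + 1) ≤ P e (congestion s e + 1) :=
    fun e he => hdmin e (by simp [he])
  have hcu := aux_congr_update s j d
  have hsk : ∀ k, k ≠ j → Function.update s j d k = s k := fun k hk =>
    Function.update_of_ne hk _ _
  have hsj : Function.update s j d j = d := Function.update_self ..
  have hpos := aux_congr_pos s j
  rw [hja] at hcu hpos
  have ca : congestion (Function.update s j d) a = congestion s a - 1 := by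
    have := hcu a
    simp [hda] at this; omega
  have cd : congestion (Function.update s j d) d = congestion s d + 1 := by
    have := hcu d
    simpa [hda.symm] using this
  have ce : ∀ e, e ≠ a → e ≠ d → congestion (Function.update s j d) e = congestion s e := by
    intro e he he'
    have := hcu e
    simpa [Ne.symm he, Ne.symm he'] using this
  refine hmin (Function.update s j d) ?_ ?_
  swap
  · show congestion _ a < congestion _ a
    omega
  have hge : ∀ e, e ≠ a → P e (congestion s e + 1) ≤
      P e (congestion (Function.update s j d) e + 1) := by
    intro e he
    apply hP
    by_cases hed : e = d
    · subst hed; omega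
    · rw [ce e he hed]
  have hused : ∀ k, Function.update s j d k ≠ a →
      P (Function.update s j d k) (congestion (Function.update s j d) (Function.update s j d k))
        ≤ P d (congestion s d + 1) := by
    intro k hk
    by_cases hkd : Function.update s j d k = d
    · rw [hkd, cd]
    · have hkj : k ≠ j := by rintro rfl; exact hkd hsj
      rw [ce _ hk hkd]
      rw [hsk k hkj] at hk ⊢
      exact h2 k d hk hda
  refine ⟨?_, ?_, ?_, ?_⟩
  · intro c hc
    by_cases hjc : j ∈ c
    · have := C.eq_of_mem_parts hb hc (by simp) hjc
      subst this
      exact ⟨i, hi, by rw [hsk i hij, hia]⟩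
    · obtain ⟨k, hk, hka⟩ := h1 c hc
      exact ⟨k, hk, by rw [hsk k (fun h => hjc (h ▸ hk)), hka]⟩
  · intro k e hk he
    exact (hused k hk).trans ((hdmin' e he).trans (hge e he))
  · intro e he
    rw [ca]
    exact (hP a (Nat.sub_le _ _)).trans ((h3 e he).trans (hge e he))
  · intro k hk
    have := hused k hk
    rw [ca, Nat.sub_add_cancel hpos]
    linarith

lemma aux_main {N R : Type*} [Fintype N] [DecidableEq N] [Fintype R] [DecidableEq R]
    [Nonempty R] (P : R → ℕ → ℝ) (hP : ∀ r, Monotone (P r)) (C : Finpartition (univ : Finset N))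
    (hsize : ∀ b ∈ C.parts, b.card ≤ 2) :
    ∃ s : N → R, IsCCGNE P C s := by
  have hm := fun r k => hP r (Nat.le_succ k)
  obtain ⟨s, hs, h | ⟨a, ha⟩⟩ := aux_phase1 P C hsize
  · refine ⟨s, fun b hb t => ?_⟩
    obtain ⟨i, hi⟩ := C.nonempty_of_mem_parts hb
    rcases aux_block (hsize b hb) hi with rfl | ⟨j, hij, rfl⟩
    · exact aux_single _ _ _ (hs i) t
    apply aux_pair _ _ _ _ hij
    intro x y c' hc
    have hne : s i ≠ s j := fun he => h _ hb ⟨i, hi, j, by simp, hij, he⟩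
    apply aux_num_split P hP _ c' _ _ x y hne (hs i) _ _ hc
    · intro d _
      by_cases hd : d = s j
      · subst hd; exact hm _ _
      · exact hs j d hd
    · have := hs j (s i) hne
      have := hm (s i) (congestion s (s i))
      simp only [Nat.succ_eq_add_one] at this
      linarith
  · by_cases hN : Nonempty N
    swap
    · exact ⟨s, fun b hb => by
        obtain ⟨i, _⟩ := C.nonempty_of_mem_parts hb
        exact absurd ⟨i⟩ hN⟩
    obtain ⟨i⟩ := hN
    obtain ⟨k₀, _, hk₀⟩ := ha _ (C.part_mem.2 (mem_univ i))
    have h3 : ∀ d, d ≠ a → P a (congestion s a) ≤ P d (congestion s d + 1) := by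
      subst hk₀; exact hs k₀
    refine aux_phase2 P hP C hsize a s ⟨ha, ?_, h3, ?_⟩
    · intro k d _ _
      by_cases hd : d = s k
      · subst hd; exact hm _ _
      · exact hs k d hd
    · intro k hk
      have := hs k a hk.symm
      have := hm a (congestion s a)
      simp only [Nat.succ_eq_add_one] at this
      linarith

/-- **Theorem (pairs admit pure NE).** If `G` is a simple congestion game (nonnegative,
nondecreasing costs) and every block of the partition `C` has size at most 2, then the
coalitional congestion game `G^C` possesses a pure Nash equilibrium. -/
theorem ccg_pairs_pure_NE {N R : Type*} [Fintype N] [DecidableEq N]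
    [Fintype R] [DecidableEq R] [Nonempty R]
    (P : R → ℕ → ℝ)
    (hP0 : ∀ r : R, ∀ k : ℕ, 1 ≤ k → k ≤ Fintype.card N → 0 ≤ P r k)
    (hPmono : ∀ r : R, ∀ k : ℕ, 1 ≤ k → k + 1 ≤ Fintype.card N → P r k ≤ P r (k + 1))
    (C : Finpartition (univ : Finset N))
    (hsize : ∀ b ∈ C.parts, b.card ≤ 2) :
    ∃ s : N → R, IsCCGNE P C s := by
  obtain ⟨s, hs⟩ := aux_main (N := N) (fun r k => P r (max 1 (min k (Fintype.card N)))) (by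
    intro r
    apply monotone_nat_of_le_succ
    intro k
    by_cases h : 1 ≤ k ∧ k + 1 ≤ Fintype.card N
    · have e1 : max 1 (min k (Fintype.card N)) = k := by omega
      have e2 : max 1 (min (k + 1) (Fintype.card N)) = k + 1 := by omega
      rw [e1, e2]
      exact hPmono r k h.1 h.2
    · have e1 : max 1 (min k (Fintype.card N)) = max 1 (min (k + 1) (Fintype.card N)) := by omega
      rw [e1]) C hsize
  refine ⟨s, fun b hb t => ?_⟩
  have key : ∀ s' : N → R, coalPay (fun r k => P r (max 1 (min k (Fintype.card N)))) s' b
      = coalPay P s' b := by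
    intro s'
    unfold coalPay
    apply Finset.sum_congr rfl
    intro i _
    unfold pay
    have h1 := aux_congr_pos s' i
    have h2 := aux_congr_le s' (s' i)
    have e1 : max 1 (min (congestion s' (s' i)) (Fintype.card N)) = congestion s' (s' i) := by omega
    simp only [e1]
  have := hs b hb t
  rwa [key, key] at this
end

section
/- Let G be a simple congestion game, C a partition of the player set N, and G^C the induced coalitional congestion game. Let s be a strategy profile such that within every block of C distinct members choose distinct resources, and suppose the congestion vector c(s) equals the congestion vector of some pure Nash equilibrium of the underlying game G. Then s is a pure Nash equilibrium of G^C. -/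
open Finset

/-- `s` is a pure Nash equilibrium of the underlying simple congestion game: no player can
strictly decrease his payment by unilaterally switching to another resource. -/
def IsNE {N R : Type*} [Fintype N] [DecidableEq N] [DecidableEq R]
    (P : R → ℕ → ℝ) (s : N → R) : Prop :=
  ∀ i : N, ∀ r : R, pay P s i ≤ pay P (Function.update s i r) i

lemma aux_coalPay {N R : Type*} [Fintype N] [Fintype R] [DecidableEq R]
    (P : R → ℕ → ℝ) (s : N → R) (b : Finset N) :
    coalPay P s b = ∑ r : R, ((b.filter fun i => s i = r).card : ℝ) * P r (congestion s r) := by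
  unfold coalPay
  rw [← Finset.sum_fiberwise b s]
  refine Finset.sum_congr rfl fun r _ => ?_
  rw [← nsmul_eq_mul]
  apply Finset.sum_eq_card_nsmul
  intro i hi
  have h := (Finset.mem_filter.1 hi).2
  simp [pay, h]

lemma aux_split {N R : Type*} [Fintype N] [DecidableEq N] [DecidableEq R]
    (s : N → R) (b : Finset N) (r : R) :
    congestion s r = (b.filter fun i => s i = r).card + (bᶜ.filter fun i => s i = r).card := by
  unfold congestion
  rw [← Finset.card_union_of_disjoint, ← Finset.filter_union, Finset.union_compl]
  exact Finset.disjoint_filter_filter disjoint_compl_right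

lemma aux_dev {N R : Type*} [Fintype N] [DecidableEq N] [DecidableEq R]
    (s t : N → R) (b : Finset N) (r : R) :
    congestion (deviate s t b) r + (b.filter fun i => s i = r).card
      = congestion s r + (b.filter fun i => deviate s t b i = r).card := by
  rw [aux_split s b r, aux_split (deviate s t b) b r]
  have : (bᶜ.filter fun i => deviate s t b i = r) = (bᶜ.filter fun i => s i = r) := by
    apply Finset.filter_congr
    intro i hi
    have : i ∉ b := by simpa using hi
    simp [deviate, this]
  rw [this]
  omega

lemma aux_NE {N R : Type*} [Fintype N] [DecidableEq N] [DecidableEq R]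
    (P : R → ℕ → ℝ) (t : N → R) (h : IsNE P t) (q r : R) (hq : 1 ≤ congestion t q)
    (hne : q ≠ r) : P q (congestion t q) ≤ P r (congestion t r + 1) := by
  obtain ⟨i, hi⟩ := Finset.card_pos.1 hq
  have hi : t i = q := by simpa using hi
  have h1 := h i r
  have h2 : congestion (Function.update t i r) r = congestion t r + 1 := by
    unfold congestion
    rw [← Finset.card_insert_of_notMem (a := i)]
    · congr 1
      ext j
      by_cases hj : j = i
      · subst hj; simp
      · simp [hj]
    · simp [hi, hne]
  simpa [pay, hi, h2] using h1

/-- **Proposition.** If within every block of `C` distinct members choose distinct resources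
at `s`, and the congestion vector of `s` equals the congestion vector of some pure Nash
equilibrium of the underlying game `G`, then `s` is a pure Nash equilibrium of `G^C`. -/
theorem ccg_NE_of_injective_blocks_of_NE_congestion {N R : Type*} [Fintype N] [DecidableEq N]
    [Fintype R] [DecidableEq R]
    (P : R → ℕ → ℝ)
    (hP0 : ∀ r : R, ∀ k : ℕ, 1 ≤ k → k ≤ Fintype.card N → 0 ≤ P r k)
    (hPmono : ∀ r : R, ∀ k : ℕ, 1 ≤ k → k + 1 ≤ Fintype.card N → P r k ≤ P r (k + 1))
    (C : Finpartition (univ : Finset N))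
    (s : N → R)
    (hinj : ∀ b ∈ C.parts, ∀ i ∈ b, ∀ j ∈ b, i ≠ j → s i ≠ s j)
    (hcong : ∃ t : N → R, IsNE P t ∧ ∀ r : R, congestion t r = congestion s r) :
    IsCCGNE P C s := by
  obtain ⟨t₀, hNE, hc⟩ := hcong
  intro b hb t
  obtain ⟨m, hm, hmax⟩ := Finset.exists_max_image b (pay P s) (C.nonempty_of_mem_parts hb)
  set L := pay P s m with hL
  have hle : ∀ r, congestion (deviate s t b) r ≤ Fintype.card N := fun r =>
    (Finset.card_le_univ _)
  have hmono : ∀ r k l, 1 ≤ k → k ≤ l → l ≤ Fintype.card N → P r k ≤ P r l := by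
    intro r k l hk hkl
    induction l, hkl using Nat.le_induction with
    | base => intro _; exact le_rfl
    | succ l hl ih => intro h; exact (ih (by omega)).trans (hPmono r l (by omega) h)
  have hpos : ∀ i, 1 ≤ congestion s (s i) := fun i =>
    Finset.card_pos.2 ⟨i, by simp⟩
  have hNE' : ∀ r, s m ≠ r → L ≤ P r (congestion s r + 1) := by
    intro r hr
    have := aux_NE P t₀ hNE (s m) r (by rw [hc]; exact hpos m) hr
    rwa [hc, hc] at this
  have hcard : ∀ f : N → R, ∑ r : R, ((b.filter fun i => f i = r).card : ℝ) = b.card := by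
    intro f
    rw [← Nat.cast_sum, ← Finset.card_eq_sum_card_fiberwise (fun i _ => by simp)]
  have key : ∀ r : R, ((b.filter fun i => s i = r).card : ℝ) * P r (congestion s r)
      + (((b.filter fun i => deviate s t b i = r).card : ℝ)
        - ((b.filter fun i => s i = r).card : ℝ)) * L
      ≤ ((b.filter fun i => deviate s t b i = r).card : ℝ)
        * P r (congestion (deviate s t b) r) := by
    intro r
    have hd := aux_dev s t b r
    have ha1 : (b.filter fun i => s i = r).card ≤ 1 := by
      rw [Finset.card_le_one]
      intro i hi j hj
      simp only [Finset.mem_filter] at hi hj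
      by_contra hij
      exact hinj b hb i hi.1 j hj.1 hij (hi.2.trans hj.2.symm)
    have hn := hle r
    have hA : 1 ≤ (b.filter fun i => s i = r).card →
        P r (congestion s r) ≤ L ∧ 1 ≤ congestion s r := by
      intro h
      obtain ⟨i, hi⟩ := Finset.card_pos.1 h
      simp only [Finset.mem_filter] at hi
      have h1 := hmax i hi.1
      have h2 := hpos i
      rw [hi.2] at h2
      simp only [pay, hi.2] at h1
      exact ⟨by simpa [hL, pay] using h1, h2⟩
    have hB : congestion s r + 1 ≤ congestion (deviate s t b) r →
        L ≤ P r (congestion (deviate s t b) r) := by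
      intro h
      by_cases hr : s m = r
      · have h2 := hpos m
        rw [hL, pay, hr]
        rw [hr] at h2
        exact hmono r _ _ h2 (by omega) hn
      · exact (hNE' r hr).trans (hmono r _ _ (by omega) h hn)
    generalize (b.filter fun i => s i = r).card = a at *
    generalize (b.filter fun i => deviate s t b i = r).card = c at *
    generalize congestion (deviate s t b) r = k' at *
    generalize congestion s r = k at *
    obtain rfl | rfl : a = 0 ∨ a = 1 := by omega
    · rcases Nat.eq_zero_or_pos c with rfl | hc0
      · simp
      · have := hB (by omega)
        have h3 : (0:ℝ) ≤ c := by positivity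
        push_cast
        nlinarith
    · obtain ⟨hA1, hA2⟩ := hA le_rfl
      rcases Nat.eq_zero_or_pos c with rfl | hc0
      · push_cast
        linarith
      · obtain ⟨d, rfl⟩ : ∃ d, c = d + 1 := ⟨c - 1, by omega⟩
        have h4 := hmono r k k' hA2 (by omega) hn
        rcases Nat.eq_zero_or_pos d with rfl | hd0
        · push_cast
          linarith
        · have := hB (by omega)
          have h3 : (0:ℝ) ≤ d := by positivity
          push_cast
          nlinarith
  have hsum := Finset.sum_le_sum (fun r (_ : r ∈ (univ : Finset R)) => key r)
  rw [Finset.sum_add_distrib, ← Finset.sum_mul, Finset.sum_sub_distrib, hcard, hcard,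
    sub_self, zero_mul, add_zero] at hsum
  rw [aux_coalPay, aux_coalPay]
  exact hsum
end

section
/- Let G be a simple congestion game, C a partition of the player set N, and let the restricted coalitional congestion game \overline{G^C} be the game in which each coalition's strategy set consists only of those assignments of its members to resources in which distinct members receive distinct resources, with coalition payments as in G^C. Let s be a strategy profile of \overline{G^C} (so within every block distinct members choose distinct resources). If the congestion vector c(s) equals the congestion vector of some pure Nash equilibrium of the underlying game G, then s is a pure Nash equilibrium of \overline{G^C}. -/
open Finset

theorem congestion_split {N R : Type*} [Fintype N] [DecidableEq N] [DecidableEq R]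
    (s : N → R) (b : Finset N) (h : Set.InjOn s b) (r : R) :
    congestion s r = (if r ∈ b.image s then 1 else 0) + ∑ i ∈ bᶜ, if s i = r then 1 else 0 := by
  have h1 : (∑ i ∈ b, if s i = r then 1 else 0) = (if r ∈ b.image s then 1 else 0 : ℕ) := by
    rw [← Finset.sum_image (f := fun x => if x = r then 1 else 0) h, Finset.sum_ite_eq']
  rw [← h1, Finset.sum_add_sum_compl, congestion, Finset.card_filter]

theorem coalPay_image {N R : Type*} [Fintype N] [DecidableEq N] [DecidableEq R]
    (P : R → ℕ → ℝ) (s : N → R) (b : Finset N) (h : Set.InjOn s b) :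
    coalPay P s b = ∑ r ∈ b.image s, P r (congestion s r) := by
  rw [Finset.sum_image h]; rfl

theorem sum_le_of_card {R : Type*} (A B : Finset R) (f g : R → ℝ) (hc : A.card = B.card)
    (h : ∀ x ∈ A, ∀ y ∈ B, f x ≤ g y) : ∑ x ∈ A, f x ≤ ∑ y ∈ B, g y := by
  rcases A.eq_empty_or_nonempty with rfl | hA
  · have : B = ∅ := by simpa using hc.symm
    simp [this]
  · obtain ⟨m, hm, hmax⟩ := A.exists_max_image f hA
    calc _ ≤ A.card • f m := Finset.sum_le_card_nsmul _ _ _ hmax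
      _ = B.card • f m := by rw [hc]
      _ ≤ _ := Finset.card_nsmul_le_sum _ _ _ (fun y hy => h m hm y hy)

theorem ne_le {N R : Type*} [Fintype N] [DecidableEq N] [DecidableEq R]
    (P : R → ℕ → ℝ) (t : N → R) (ht : IsNE P t) (x y : R) (hxy : x ≠ y)
    (hx : congestion t x ≠ 0) : P x (congestion t x) ≤ P y (congestion t y + 1) := by
  obtain ⟨i, hi⟩ := Finset.card_ne_zero.mp hx
  simp only [Finset.mem_filter, Finset.mem_univ, true_and] at hi
  subst hi
  have h := ht i y
  have e : congestion (Function.update t i y) y = congestion t y + 1 := by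
    rw [congestion_split (Function.update t i y) {i} (by simp), congestion_split t {i} (by simp)]
    have : (∑ j ∈ ({i} : Finset N)ᶜ, if Function.update t i y j = y then 1 else 0) =
        ∑ j ∈ ({i} : Finset N)ᶜ, if t j = y then 1 else 0 := by
      apply Finset.sum_congr rfl
      intro j hj
      rw [Function.update_of_ne (by simpa using hj)]
    rw [this]
    simp [hxy.symm, add_comm]
  simpa [pay, e] using h

/-- **Lemma (restricted CCG).** Let `s` be a profile of the restricted coalitional congestion
game `\overline{G^C}` (within every block distinct members choose distinct resources). If the
congestion vector of `s` equals the congestion vector of some pure Nash equilibrium of the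
underlying game `G`, then `s` is a pure Nash equilibrium of `\overline{G^C}`: no coalition can
strictly decrease its total payment by deviating to another assignment of its members to
resources that is injective on the coalition. -/
theorem restricted_ccg_NE_of_NE_congestion {N R : Type*} [Fintype N] [DecidableEq N]
    [Fintype R] [DecidableEq R]
    (P : R → ℕ → ℝ)
    (hP0 : ∀ r : R, ∀ k : ℕ, 1 ≤ k → k ≤ Fintype.card N → 0 ≤ P r k)
    (hPmono : ∀ r : R, ∀ k : ℕ, 1 ≤ k → k + 1 ≤ Fintype.card N → P r k ≤ P r (k + 1))
    (C : Finpartition (univ : Finset N))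
    (s : N → R)
    (hinj : ∀ b ∈ C.parts, ∀ i ∈ b, ∀ j ∈ b, i ≠ j → s i ≠ s j)
    (hcong : ∃ t : N → R, IsNE P t ∧ ∀ r : R, congestion t r = congestion s r) :
    ∀ b ∈ C.parts, ∀ t : N → R, (∀ i ∈ b, ∀ j ∈ b, i ≠ j → t i ≠ t j) →
      coalPay P s b ≤ coalPay P (deviate s t b) b := by
  intro b hb t ht
  obtain ⟨t0, hne, hc⟩ := hcong
  have hs : Set.InjOn s b := fun i hi j hj e => by
    by_contra hij
    exact hinj b hb i hi j hj hij e
  have htI : Set.InjOn t b := fun i hi j hj e => by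
    by_contra hij
    exact ht i hi j hj hij e
  have hu : ∀ i ∈ b, deviate s t b i = t i := fun i hi => by simp [deviate, hi]
  have huI : Set.InjOn (deviate s t b) b := fun i hi j hj e => by
    rw [hu i hi, hu j hj] at e
    exact htI hi hj e
  rw [coalPay_image P s b hs, coalPay_image P _ b huI]
  have hcu := congestion_split (deviate s t b) b huI
  have hcs := congestion_split s b hs
  have hcompl : ∀ r, (∑ j ∈ bᶜ, if deviate s t b j = r then 1 else 0) =
      ∑ j ∈ bᶜ, if s j = r then 1 else 0 := fun r => by
    apply Finset.sum_congr rfl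
    intro j hj
    have : j ∉ b := by simpa using hj
    simp [deviate, this]
  simp only [hcompl] at hcu
  have hcard : (b.image s).card = (b.image (deviate s t b)).card := by
    rw [Finset.card_image_of_injOn hs, Finset.card_image_of_injOn huI]
  generalize deviate s t b = u at *
  generalize b.image s = A at *
  generalize b.image u = B at *
  rw [← Finset.sum_inter_add_sum_sdiff A B, ← Finset.sum_inter_add_sum_sdiff B A,
    Finset.inter_comm B A]
  apply add_le_add
  · apply le_of_eq
    apply Finset.sum_congr rfl
    intro r hr
    rw [Finset.mem_inter] at hr
    rw [hcu, hcs, if_pos hr.1, if_pos hr.2]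
  · apply sum_le_of_card
    · exact Finset.card_sdiff_comm hcard
    · intro x hx y hy
      rw [Finset.mem_sdiff] at hx hy
      have e : congestion u y = congestion t0 y + 1 := by
        rw [hc, hcu, hcs, if_pos hy.1, if_neg hy.2]; ring
      rw [e, ← hc]
      apply ne_le P t0 hne
      · rintro rfl
        exact hx.2 hy.1
      · rw [hc, hcs, if_pos hx.1]; omega
end

section
/- Let G be a simple congestion game with n players in which every cost function is affine, i.e., for each resource r there exist real numbers α_r and β_r with P_r(k) = α_r·k + β_r for all k ∈ {1,…,n}. Then for every partition C of the players, the coalitional congestion game G^C admits an exact potential. -/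
open Finset

/-- The utility of the coalition `b` at profile `s`: the sum of its members' utilities,
each utility being the negative of the member's payment. -/
def coalUtility {N R : Type*} [Fintype N] [DecidableEq R] (P : R → ℕ → ℝ) (s : N → R)
    (b : Finset N) : ℝ :=
  ∑ i ∈ b, -pay P s i

/-- The coalitional congestion game `G^C` admits an exact potential. -/
def HasExactPotential {N R : Type*} [Fintype N] [DecidableEq N] [DecidableEq R]
    (P : R → ℕ → ℝ) (C : Finpartition (univ : Finset N)) : Prop :=
  ∃ Φ : (N → R) → ℝ, ∀ b ∈ C.parts, ∀ s t : N → R,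
    Φ s - Φ (deviate s t b) = coalUtility P s b - coalUtility P (deviate s t b) b

/-- Pairwise interaction weight. -/
def ccgW {N R : Type*} [DecidableEq R] (α : R → ℝ) (s : N → R) (i j : N) : ℝ :=
  if s i = s j then α (s i) else 0

theorem ccgW_comm {N R : Type*} [DecidableEq R] (α : R → ℝ) (s : N → R) (i j : N) :
    ccgW α s i j = ccgW α s j i := by
  unfold ccgW
  by_cases h : s i = s j
  · simp [h]
  · simp [h, Ne.symm h]

theorem ccg_pay_eq {N R : Type*} [Fintype N] [DecidableEq R] (P : R → ℕ → ℝ) (α β : R → ℝ)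
    (h : ∀ r : R, ∀ k : ℕ, 1 ≤ k → k ≤ Fintype.card N → P r k = α r * (k : ℝ) + β r)
    (s : N → R) (i : N) : pay P s i = β (s i) + ∑ j, ccgW α s i j := by
  unfold pay
  have h1 : 1 ≤ congestion s (s i) := by
    unfold congestion
    exact Finset.card_pos.mpr ⟨i, by simp⟩
  have h2 : congestion s (s i) ≤ Fintype.card N := Finset.card_le_univ _
  rw [h _ _ h1 h2]
  have h3 : ∑ j, ccgW α s i j = α (s i) * (congestion s (s i) : ℝ) := by
    unfold ccgW congestion
    rw [← Finset.sum_filter, Finset.sum_const, nsmul_eq_mul, mul_comm]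
    simp only [eq_comm]
  rw [h3]; ring

/-- The part of the potential not depending on the coalition `b`. -/
noncomputable def ccgD {N R : Type*} [Fintype N] [DecidableEq N] [DecidableEq R] (α β : R → ℝ)
    (C : Finpartition (univ : Finset N)) (b : Finset N) (s : N → R) : ℝ :=
  -(∑ i ∈ bᶜ, β (s i) + 1 / 2 * ∑ i ∈ bᶜ, ∑ j ∈ bᶜ, ccgW α s i j
    + 1 / 2 * ∑ p ∈ C.parts.erase b, ∑ i ∈ p, ∑ j ∈ p, ccgW α s i j)

/-- The potential. -/
noncomputable def ccgPhi {N R : Type*} [Fintype N] [DecidableEq N] [DecidableEq R] (α β : R → ℝ)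
    (C : Finpartition (univ : Finset N)) (s : N → R) : ℝ :=
  -(∑ i, β (s i) + 1 / 2 * ∑ i, ∑ j, ccgW α s i j
    + 1 / 2 * ∑ p ∈ C.parts, ∑ i ∈ p, ∑ j ∈ p, ccgW α s i j)

theorem ccgD_deviate {N R : Type*} [Fintype N] [DecidableEq N] [DecidableEq R] (α β : R → ℝ)
    (C : Finpartition (univ : Finset N)) (b : Finset N) (hb : b ∈ C.parts) (s t : N → R) :
    ccgD α β C b (deviate s t b) = ccgD α β C b s := by
  have hd : ∀ i, i ∉ b → deviate s t b i = s i := fun i hi => by simp [deviate, hi]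
  have hw : ∀ i j, i ∉ b → j ∉ b → ccgW α (deviate s t b) i j = ccgW α s i j :=
    fun i j hi hj => by simp only [ccgW, hd i hi, hd j hj]
  have e1 : ∑ i ∈ bᶜ, β (deviate s t b i) = ∑ i ∈ bᶜ, β (s i) :=
    Finset.sum_congr rfl fun i hi => by rw [hd i (Finset.mem_compl.mp hi)]
  have e2 : ∑ i ∈ bᶜ, ∑ j ∈ bᶜ, ccgW α (deviate s t b) i j
      = ∑ i ∈ bᶜ, ∑ j ∈ bᶜ, ccgW α s i j :=
    Finset.sum_congr rfl fun i hi => Finset.sum_congr rfl fun j hj =>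
      hw i j (Finset.mem_compl.mp hi) (Finset.mem_compl.mp hj)
  have e3 : ∑ p ∈ C.parts.erase b, ∑ i ∈ p, ∑ j ∈ p, ccgW α (deviate s t b) i j
      = ∑ p ∈ C.parts.erase b, ∑ i ∈ p, ∑ j ∈ p, ccgW α s i j := by
    refine Finset.sum_congr rfl fun p hp => ?_
    obtain ⟨hne, hp⟩ := Finset.mem_erase.mp hp
    have hdis : Disjoint p b := C.disjoint hp hb hne
    exact Finset.sum_congr rfl fun i hi => Finset.sum_congr rfl fun j hj =>
      hw i j (Finset.disjoint_left.mp hdis hi) (Finset.disjoint_left.mp hdis hj)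
  unfold ccgD
  rw [e1, e2, e3]

theorem ccgPhi_eq {N R : Type*} [Fintype N] [DecidableEq N] [DecidableEq R]
    (P : R → ℕ → ℝ) (α β : R → ℝ)
    (h : ∀ r : R, ∀ k : ℕ, 1 ≤ k → k ≤ Fintype.card N → P r k = α r * (k : ℝ) + β r)
    (C : Finpartition (univ : Finset N)) (b : Finset N) (hb : b ∈ C.parts) (s : N → R) :
    ccgPhi α β C s = coalUtility P s b + ccgD α β C b s := by
  have hs : ∀ f : N → ℝ, ∑ i, f i = ∑ i ∈ b, f i + ∑ i ∈ bᶜ, f i :=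
    fun f => (Finset.sum_add_sum_compl b f).symm
  have hsym : ∑ i ∈ bᶜ, ∑ j ∈ b, ccgW α s i j = ∑ i ∈ b, ∑ j ∈ bᶜ, ccgW α s i j := by
    rw [Finset.sum_comm]
    exact Finset.sum_congr rfl fun i _ => Finset.sum_congr rfl fun j _ => ccgW_comm α s j i
  unfold ccgPhi ccgD coalUtility
  rw [← Finset.add_sum_erase _ _ hb]
  simp only [ccg_pay_eq P α β h, hs, Finset.sum_add_distrib, Finset.sum_neg_distrib]
  rw [hsym]
  ring

/-- **Theorem (affine costs yield a potential).** If every cost function of the simple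
congestion game `G` is affine on `{1,…,n}`, then for every partition `C` of the players the
coalitional congestion game `G^C` admits an exact potential. -/
theorem ccg_exact_potential_of_affine_costs {N R : Type*} [Fintype N] [DecidableEq N]
    [Fintype R] [DecidableEq R]
    (P : R → ℕ → ℝ)
    (haffine : ∀ r : R, ∃ α β : ℝ, ∀ k : ℕ, 1 ≤ k → k ≤ Fintype.card N →
      P r k = α * (k : ℝ) + β) :
    ∀ C : Finpartition (univ : Finset N), HasExactPotential P C := by
  intro C
  choose α β h using haffine
  refine ⟨ccgPhi α β C, fun b hb s t => ?_⟩
  rw [ccgPhi_eq P α β h C b hb s, ccgPhi_eq P α β h C b hb (deviate s t b),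
    ccgD_deviate α β C b hb s t]
  ring
end

section
/- Consider the simple congestion game G with four players N = {1,2,3,4}, two resources R = {A,B}, and identical cost functions P_A = P_B = P given by P(1) = 0, P(2) = 12, P(3) = 16, P(4) = 18. Let C be the partition {{1,2,3},{4}}. Then the coalitional congestion game G^C possesses no pure Nash equilibrium. -/
open Finset

def qcost (c : ℕ) : ℕ := if c = 1 then 0 else if c = 2 then 12 else if c = 3 then 16 else 18

def cpN (s : Fin 4 → Bool) (b : Finset (Fin 4)) : ℕ := ∑ i ∈ b, qcost (congestion s (s i))

lemma coalPay_eq_cpN (P : ℕ → ℝ) (h1 : P 1 = 0) (h2 : P 2 = 12) (h3 : P 3 = 16) (h4 : P 4 = 18)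
    (s : Fin 4 → Bool) (b : Finset (Fin 4)) : coalPay (fun _ => P) s b = (cpN s b : ℝ) := by
  unfold coalPay cpN
  rw [Nat.cast_sum]
  refine Finset.sum_congr rfl fun i _ => ?_
  unfold pay
  have hpos : 0 < congestion s (s i) := Finset.card_pos.mpr ⟨i, by simp⟩
  have hle : congestion s (s i) ≤ 4 := by
    simpa [congestion] using Finset.card_le_univ (univ.filter fun j => s j = s i)
  generalize congestion s (s i) = c at *
  interval_cases c <;> simp [qcost, h1, h2, h3, h4]

lemma improving_cases : ∀ a b c d : Bool,
    cpN (deviate ![a, b, c, d] ![d, d, !d, d] {0, 1, 2}) {0, 1, 2} < cpN ![a, b, c, d] {0, 1, 2} ∨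
    cpN (deviate ![a, b, c, d] ![d, d, d, !d] {3}) {3} < cpN ![a, b, c, d] {3} := by
  decide

/-- **Example (no pure NE with a coalition of size 3).** The simple congestion game with four
players, two identical resources `A = false` and `B = true` whose common cost function satisfies
`P(1) = 0`, `P(2) = 12`, `P(3) = 16`, `P(4) = 18`, and the partition `C = {{1,2,3},{4}}`,
induces a coalitional congestion game with no pure Nash equilibrium. -/
theorem no_pure_NE_triple_coalition_example
    (P : ℕ → ℝ) (h1 : P 1 = 0) (h2 : P 2 = 12) (h3 : P 3 = 16) (h4 : P 4 = 18)
    (C : Finpartition (univ : Finset (Fin 4)))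
    (hC : C.parts = {({0, 1, 2} : Finset (Fin 4)), ({3} : Finset (Fin 4))}) :
    ¬ ∃ s : Fin 4 → Bool, IsCCGNE (fun _ => P) C s := by
  rintro ⟨s, hs⟩
  have e : s = ![s 0, s 1, s 2, s 3] := by
    ext i; fin_cases i <;> rfl
  have key := improving_cases (s 0) (s 1) (s 2) (s 3)
  rw [← e] at key
  rcases key with h | h
  · have := hs {0, 1, 2} (by simp [hC]) ![s 3, s 3, !(s 3), s 3]
    rw [coalPay_eq_cpN P h1 h2 h3 h4, coalPay_eq_cpN P h1 h2 h3 h4, Nat.cast_le] at this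
    omega
  · have := hs {3} (by simp [hC]) ![s 3, s 3, s 3, !(s 3)]
    rw [coalPay_eq_cpN P h1 h2 h3 h4, coalPay_eq_cpN P h1 h2 h3 h4, Nat.cast_le] at this
    omega
end

section
/- Consider the (non-simple) congestion game G with three players N = {1,2,3} and three resources R = {A,B,C}, in which each player's strategy set consists of all 2-element subsets of R, each resource has cost function P(k) = 6 − 6/k (so P(1) = 0, P(2) = 3, P(3) = 4), and player i's payment at a profile s is the sum over r ∈ s_i of P(c(s)_r), where c(s)_r is the number of players j with r ∈ s_j. Let C be the partition {{1,2},{3}}. Then the coalitional congestion game G^C, in which the coalition {1,2} chooses a pair of strategies (s_1, s_2) and pays the sum of the two players' payments while player 3 chooses s_3 and pays his own payment, possesses no pure Nash equilibrium. -/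
open Finset

/-- A strategy in the non-simple congestion game: a 2-element subset of the three resources. -/
def TwoSet : Type := {t : Finset (Fin 3) // t.card = 2}

/-- The congestion of resource `r` at profile `s`: the number of players whose chosen pair
contains `r`. -/
def congestion6 (s : Fin 3 → TwoSet) (r : Fin 3) : ℕ :=
  (univ.filter fun j => r ∈ (s j).1).card

/-- The payment of player `i` at profile `s`: the sum over the resources in `i`'s chosen pair
of the cost `P(k) = 6 - 6/k` evaluated at the congestion `k` of the resource. -/
noncomputable def pay6 (s : Fin 3 → TwoSet) (i : Fin 3) : ℝ :=
  ∑ r ∈ (s i).1, (6 - 6 / (congestion6 s r : ℝ))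

def omit6 (a : Fin 3) : TwoSet := ⟨univ.erase a, by revert a; decide⟩

theorem omit6_surj (t : TwoSet) : ∃ a, t = omit6 a := by
  obtain ⟨t, ht⟩ := t
  have : ∀ t : Finset (Fin 3), t.card = 2 → ∃ a, t = univ.erase a := by decide
  obtain ⟨a, ha⟩ := this t ht
  exact ⟨a, Subtype.ext ha⟩

def payN (s : Fin 3 → TwoSet) (i : Fin 3) : ℕ :=
  ∑ r ∈ (s i).1, (6 - 6 / congestion6 s r)

theorem pay6_eq (s : Fin 3 → TwoSet) (i : Fin 3) : pay6 s i = (payN s i : ℝ) := by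
  unfold pay6 payN
  rw [Nat.cast_sum]
  refine Finset.sum_congr rfl fun r _ => ?_
  have h : congestion6 s r ≤ 3 := by
    unfold congestion6
    exact (Finset.card_le_univ _).trans (by simp)
  generalize congestion6 s r = k at h
  interval_cases k <;> norm_num

theorem key6 : ∀ a b c : Fin 3,
    (∃ x y : Fin 3, payN ![omit6 x, omit6 y, omit6 c] 0 + payN ![omit6 x, omit6 y, omit6 c] 1 <
      payN ![omit6 a, omit6 b, omit6 c] 0 + payN ![omit6 a, omit6 b, omit6 c] 1) ∨
    (∃ z : Fin 3, payN ![omit6 a, omit6 b, omit6 z] 2 < payN ![omit6 a, omit6 b, omit6 c] 2) := by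
  decide +kernel

/-- **Example (non-simple underlying game, no pure NE).** In the congestion game with three
players, three resources `A,B,C`, strategies the 2-element subsets of the resources, and cost
function `P(k) = 6 - 6/k` on every resource, with partition `C = {{1,2},{3}}`, the induced
coalitional congestion game (coalition `{1,2}` jointly chooses the strategies of players `1`
and `2` and pays the sum of their payments; player `3` plays alone) has no pure Nash
equilibrium. -/
theorem no_pure_NE_nonsimple_example :
    ¬ ∃ s : Fin 3 → TwoSet,
      (∀ t₀ t₁ : TwoSet,
        pay6 s 0 + pay6 s 1 ≤
          pay6 (Function.update (Function.update s 0 t₀) 1 t₁) 0 +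
            pay6 (Function.update (Function.update s 0 t₀) 1 t₁) 1) ∧
      (∀ t₂ : TwoSet, pay6 s 2 ≤ pay6 (Function.update s 2 t₂) 2) := by
  rintro ⟨s, h1, h2⟩
  obtain ⟨a, ha⟩ := omit6_surj (s 0)
  obtain ⟨b, hb⟩ := omit6_surj (s 1)
  obtain ⟨c, hc⟩ := omit6_surj (s 2)
  have hs : s = ![omit6 a, omit6 b, omit6 c] := by
    funext i; fin_cases i <;> simp [ha, hb, hc]
  subst hs
  rcases key6 a b c with ⟨x, y, h⟩ | ⟨z, h⟩
  · have h' := h1 (omit6 x) (omit6 y)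
    have e : Function.update (Function.update ![omit6 a, omit6 b, omit6 c] 0 (omit6 x)) 1 (omit6 y)
        = ![omit6 x, omit6 y, omit6 c] := by
      funext i; fin_cases i <;> simp [Function.update]
    rw [e] at h'
    simp only [pay6_eq] at h'
    norm_cast at h'
    omega
  · have h' := h2 (omit6 z)
    have e : Function.update ![omit6 a, omit6 b, omit6 c] 2 (omit6 z)
        = ![omit6 a, omit6 b, omit6 z] := by
      funext i; fin_cases i <;> simp [Function.update]
    rw [e] at h'
    simp only [pay6_eq] at h'
    norm_cast at h'
    omega
end

section
/- Consider the simple congestion game with three players N = {1,2,3}, two resources R = {A,B}, and cost values P_A(1) = a_1, P_A(2) = a_2, P_A(3) = a_3 and P_B(1) = b_1, P_B(2) = b_2, P_B(3) = b_3 (arbitrary real numbers). Let C be the partition {{1,2},{3}}, and let G^C be the induced two-player coalitional congestion game (the coalition {1,2} chooses a resource for each of its two members and its utility is the negative of the sum of their payments; player 3 chooses a resource and his utility is the negative of his payment). If G^C admits an exact potential, then 2a_2 = a_1 + a_3 and 2b_2 = b_1 + b_3. -/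
open Finset

/-- **Example (potential forces linearity).** In the simple congestion game with three players,
two resources `A = false` and `B = true`, and arbitrary cost values `P_A(1),P_A(2),P_A(3)` and
`P_B(1),P_B(2),P_B(3)`, with the partition `C = {{1,2},{3}}`: if the induced two-player
coalitional congestion game admits an exact potential, then `2·P_A(2) = P_A(1) + P_A(3)` and
`2·P_B(2) = P_B(1) + P_B(3)`. -/
theorem potential_implies_linear_three_player_example
    (P : Bool → ℕ → ℝ)
    (C : Finpartition (univ : Finset (Fin 3)))
    (hC : C.parts = {({0, 1} : Finset (Fin 3)), ({2} : Finset (Fin 3))})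
    (hpot : HasExactPotential P C) :
    2 * P false 2 = P false 1 + P false 3 ∧ 2 * P true 2 = P true 1 + P true 3 := by
  obtain ⟨Φ, h⟩ := hpot
  have h1 := h {0, 1} (by simp [hC])
  have h2 := h {2} (by simp [hC])
  have key : ∀ x y x' y' z : Bool,
      Φ ![x, y, z] - Φ ![x', y', z] =
        coalUtility P ![x, y, z] {0, 1} - coalUtility P ![x', y', z] {0, 1} := by
    intro x y x' y' z
    have e : deviate ![x, y, z] ![x', y', z] ({0, 1} : Finset (Fin 3)) = ![x', y', z] := by
      funext i; fin_cases i <;> simp [deviate]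
    have := h1 ![x, y, z] ![x', y', z]
    rwa [e] at this
  have key2 : ∀ x y z z' : Bool,
      Φ ![x, y, z] - Φ ![x, y, z'] =
        coalUtility P ![x, y, z] {2} - coalUtility P ![x, y, z'] {2} := by
    intro x y z z'
    have e : deviate ![x, y, z] ![x, y, z'] ({2} : Finset (Fin 3)) = ![x, y, z'] := by
      funext i; fin_cases i <;> simp [deviate]
    have := h2 ![x, y, z] ![x, y, z']
    rwa [e] at this
  have c12 : ∀ x y z : Bool, coalUtility P ![x, y, z] {0, 1} =
      -P x (congestion ![x, y, z] x) + -P y (congestion ![x, y, z] y) := by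
    intro x y z
    simp [coalUtility, pay, add_comm]
  have c3 : ∀ x y z : Bool, coalUtility P ![x, y, z] {2} =
      -P z (congestion ![x, y, z] z) := by
    intro x y z
    simp [coalUtility, pay]
  have cg : ∀ x y z r : Bool, congestion ![x, y, z] r =
      (if x = r then 1 else 0) + (if y = r then 1 else 0) + (if z = r then 1 else 0) := by
    decide
  simp only [c12, c3, cg] at key key2
  have k1 := key false false false true false
  have k2 := key false false false true true
  have k3 := key true true false true false
  have k4 := key true true false true true
  have p1 := key2 false false false true
  have p2 := key2 false true false true
  have p3 := key2 true true false true
  norm_num at k1 k2 k3 k4 p1 p2 p3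
  constructor <;> linarith
end

section
/- Let N be a finite set of n elements, C a partition of N in which every block has size at most 2, and R a finite set. Let c : R → ℕ satisfy Σ_{r∈R} c(r) = n and c(r) ≤ |C| for every r ∈ R. Then there exists a function s : N → R with |{i ∈ N : s(i) = r}| = c(r) for every r, such that for every block of C of size 2 the two members of the block are mapped to distinct resources. -/
open Finset

/-- **Rearrangement lemma (Case 1).** Let `C` be a partition of a finite set `N` of `n`
elements in which every block has size at most 2, and let `c : R → ℕ` be a congestion vector
summing to `n` whose every entry is at most the number of blocks of `C`. Then `c` can be
realized by a profile `s : N → R` in which the two members of every block of size 2 are mapped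
to distinct resources. -/
theorem realize_congestion_with_injective_pairs {N R : Type*} [Fintype N] [DecidableEq N]
    [Fintype R] [DecidableEq R]
    (C : Finpartition (univ : Finset N))
    (hsize : ∀ b ∈ C.parts, b.card ≤ 2)
    (c : R → ℕ)
    (hsum : ∑ r : R, c r = Fintype.card N)
    (hle : ∀ r : R, c r ≤ C.parts.card) :
    ∃ s : N → R,
      (∀ r : R, (univ.filter fun i => s i = r).card = c r) ∧
      ∀ b ∈ C.parts, b.card = 2 → ∀ i ∈ b, ∀ j ∈ b, i ≠ j → s i ≠ s j := by
  classical
  have hdisj : ∀ b ∈ C.parts, ∀ b' ∈ C.parts, ∀ x, x ∈ b → x ∈ b' → b = b' :=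
    fun b hb b' hb' x hx hx' => C.disjoint.elim_finset hb hb' x hx hx'
  let bad : (N → R) → Finset (Finset N) := fun s =>
    C.parts.filter (fun b => ∃ i ∈ b, ∃ j ∈ b, i ≠ j ∧ s i = s j)
  have key : ∀ k : ℕ, ∀ s : N → R, (∀ r : R, (univ.filter fun i => s i = r).card = c r) →
      (bad s).card = k → ∃ s : N → R,
      (∀ r : R, (univ.filter fun i => s i = r).card = c r) ∧
      ∀ b ∈ C.parts, b.card = 2 → ∀ i ∈ b, ∀ j ∈ b, i ≠ j → s i ≠ s j := by
    intro k
    induction k using Nat.strong_induction_on with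
    | _ k ih =>
    intro s hs hk
    by_cases hb : ∃ b ∈ C.parts, ∃ i ∈ b, ∃ j ∈ b, i ≠ j ∧ s i = s j
    swap
    · refine ⟨s, hs, fun b hbC _ i hi j hj hij he => hb ⟨b, hbC, i, hi, j, hj, hij, he⟩⟩
    obtain ⟨b, hbC, i, hi, j, hj, hij, he⟩ := hb
    have hbe : ∀ x ∈ b, x = i ∨ x = j := by
      intro x hx
      by_contra hne
      push Not at hne
      have h3 : ({x, i, j} : Finset N).card = 3 := by
        rw [card_eq_three]; exact ⟨x, i, j, hne.1, hne.2, hij, rfl⟩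
      have : ({x, i, j} : Finset N) ⊆ b := by
        intro y hy; simp at hy; rcases hy with rfl | rfl | rfl <;> assumption
      have := card_le_card this
      have := hsize b hbC
      omega
    have hB : ∃ B ∈ C.parts, ∀ x ∈ B, s x ≠ s i := by
      by_contra hcon
      push Not at hcon
      haveI : Nonempty N := ⟨i⟩
      choose! f hf hfs using hcon
      obtain ⟨x, hx, hxs, hxf⟩ : ∃ x ∈ b, s x = s i ∧ x ≠ f b := by
        by_cases h : i = f b
        · exact ⟨j, hj, he.symm, fun h' => hij (h.trans h'.symm)⟩
        · exact ⟨i, hi, rfl, h⟩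
      have hinj : Set.InjOn f (C.parts : Set (Finset N)) := by
        intro B hB B' hB' h
        exact hdisj B hB B' hB' (f B) (hf B hB) (h ▸ hf B' hB')
      have hx' : x ∉ C.parts.image f := by
        intro h
        obtain ⟨B, hB, rfl⟩ := mem_image.1 h
        exact hxf (by rw [hdisj B hB b hbC _ (hf B hB) hx])
      have hsub : insert x (C.parts.image f) ⊆ univ.filter (fun y => s y = s i) := by
        intro y hy
        simp only [mem_filter, mem_univ, true_and]
        rcases mem_insert.1 hy with rfl | hy
        · exact hxs
        · obtain ⟨B, hB, rfl⟩ := mem_image.1 hy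
          exact hfs B hB
      have h1 := card_le_card hsub
      rw [card_insert_of_notMem hx', card_image_of_injOn hinj, hs] at h1
      have := hle (s i)
      omega
    obtain ⟨B, hBC, hB⟩ := hB
    obtain ⟨k', hk'⟩ := C.nonempty_of_mem_parts hBC
    have hsk := hB k' hk'
    have hbB : b ≠ B := fun h => hB i (h ▸ hi) rfl
    refine ih (bad (s ∘ Equiv.swap i k')).card ?_ (s ∘ Equiv.swap i k') ?_ rfl
    · rw [← hk]
      apply card_lt_card
      rw [ssubset_iff_of_subset]
      · refine ⟨b, mem_filter.2 ⟨hbC, i, hi, j, hj, hij, he⟩, ?_⟩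
        intro h
        obtain ⟨-, u, hu, v, hv, huv, h⟩ := mem_filter.1 h
        have hjk : j ≠ k' := fun h => hbB (hdisj b hbC B hBC j hj (h ▸ hk'))
        have hsj : Equiv.swap i k' j = j := Equiv.swap_apply_of_ne_of_ne hij.symm hjk
        rcases hbe u hu with rfl | rfl <;> rcases hbe v hv with rfl | rfl <;>
          simp [hsj] at h huv <;> grind
      · intro D hD
        obtain ⟨hDC, u, hu, v, hv, huv, h⟩ := mem_filter.1 hD
        refine mem_filter.2 ⟨hDC, ?_⟩
        by_cases hDb : D = b
        · subst hDb; exact ⟨i, hi, j, hj, hij, he⟩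
        have hiD : i ∉ D := fun h => hDb (hdisj D hDC b hbC i h hi)
        have hui : u ≠ i := fun h => hiD (h ▸ hu)
        have hvi : v ≠ i := fun h => hiD (h ▸ hv)
        refine ⟨u, hu, v, hv, huv, ?_⟩
        have hkB : k' ∈ D → D = B := fun h => hdisj D hDC B hBC k' h hk'
        simp only [Function.comp, Equiv.swap_apply_def, hui, hvi, if_false] at h
        grind
    · intro r
      rw [← hs r]
      refine card_bij (fun x _ => Equiv.swap i k' x) ?_ ?_ ?_
      · intro x hx; simpa using hx
      · intro x _ y _ h; exact (Equiv.swap i k').injective h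
      · intro y hy
        exact ⟨Equiv.swap i k' y, by simpa using hy, by simp⟩
  have hcard : Fintype.card N = Fintype.card (Σ r : R, Fin (c r)) := by simp [hsum]
  let e := Fintype.equivOfCardEq hcard
  refine key _ (fun x => (e x).1) ?_ rfl
  intro r
  have : (univ : Finset (Fin (c r))).card = c r := by simp
  rw [← this]
  symm
  refine card_bij (fun x _ => e.symm ⟨r, x⟩) ?_ ?_ ?_
  · intro x _; simp
  · intro x _ y _ h; simpa using h
  · intro y hy
    simp only [mem_filter, mem_univ, true_and] at hy
    subst hy
    exact ⟨(e y).2, mem_univ _, by simp⟩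
end

section
/- Let N be a finite set of n elements, C a partition of N in which every block has size at most 2, and R a finite set. Let c : R → ℕ satisfy Σ_{r'∈R} c(r') = n, and suppose c(r) ≥ |C| for some resource r ∈ R. Then there exists a function s : N → R with |{i ∈ N : s(i) = r'}| = c(r') for every r' ∈ R, such that every block of C contains at least one member mapped to r, and whenever the two members of a block of size 2 are mapped to the same resource, that resource is r. -/
open Finset

/-- **Rearrangement lemma (Case 2).** Let `C` be a partition of a finite set `N` of `n`
elements in which every block has size at most 2, and let `c : R → ℕ` be a congestion vector
summing to `n` with `c r ≥ |C|` for some resource `r`, where `|C|` is the number of blocks.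
Then `c` can be realized by a profile `s : N → R` in which every block has at least one member
mapped to `r`, and whenever the two members of a block of size 2 are mapped to the same
resource, that resource is `r`. -/
theorem realize_congestion_with_crowded_resource {N R : Type*} [Fintype N] [DecidableEq N]
    [Fintype R] [DecidableEq R]
    (C : Finpartition (univ : Finset N))
    (hsize : ∀ b ∈ C.parts, b.card ≤ 2)
    (c : R → ℕ)
    (hsum : ∑ r' : R, c r' = Fintype.card N)
    (r : R)
    (hge : C.parts.card ≤ c r) :
    ∃ s : N → R,
      (∀ r' : R, (univ.filter fun i => s i = r').card = c r') ∧
      (∀ b ∈ C.parts, ∃ i ∈ b, s i = r) ∧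
      ∀ b ∈ C.parts, ∀ i ∈ b, ∀ j ∈ b, i ≠ j → s i = s j → s i = r := by
  have hne : ∀ b : C.parts, ∃ i, i ∈ b.1 := fun b => C.nonempty_of_mem_parts b.2
  choose f hf using hne
  have hT : (univ.image f).card ≤ c r :=
    card_image_le.trans (by simpa using hge)
  have hcn : c r ≤ (univ : Finset N).card := by
    rw [card_univ, ← hsum]
    exact single_le_sum (f := c) (fun _ _ => Nat.zero_le _) (mem_univ r)
  obtain ⟨U, hTU, -, hU⟩ := exists_subsuperset_card_eq (subset_univ (univ.image f)) hT hcn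
  have hcard : Fintype.card N = Fintype.card (Σ r' : R, Fin (c r')) := by
    simp [hsum]
  let e : N ≃ Σ r' : R, Fin (c r') := Fintype.equivOfCardEq hcard
  have h0 : ∀ r' : R, (univ.filter fun i => (e i).1 = r').card = c r' := by
    intro r'
    rw [← Fintype.card_subtype,
      Fintype.card_congr ((e.subtypeEquiv (fun _ => Iff.rfl)).trans
        (Equiv.sigmaSubtype (β := fun r' => Fin (c r')) r')),
      Fintype.card_fin]
  have hUe : Fintype.card {x // x ∈ U} = Fintype.card {x // (e x).1 = r} := by
    rw [Fintype.card_subtype (fun x => (e x).1 = r), h0]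
    simpa using hU
  let g : {x // x ∈ U} ≃ {x // (e x).1 = r} := Fintype.equivOfCardEq hUe
  let p : Equiv.Perm N := g.extendSubtype
  have hp : ∀ b (hb : b ∈ C.parts), (e (p (f ⟨b, hb⟩))).1 = r := fun b hb =>
    g.extendSubtype_mem _ (hTU (mem_image_of_mem f (mem_univ _)))
  refine ⟨fun i => (e (p i)).1, ?_, fun b hb => ⟨_, hf ⟨b, hb⟩, hp b hb⟩, ?_⟩
  · intro r'
    rw [← h0 r', ← Fintype.card_subtype, ← Fintype.card_subtype]
    exact Fintype.card_congr (p.subtypeEquiv (fun _ => Iff.rfl))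
  · intro b hb i hi j hj hij hs
    have h1 := hp b hb
    have h2 : f ⟨b, hb⟩ = i ∨ f ⟨b, hb⟩ = j := by
      by_contra! h
      have : 2 < b.card := two_lt_card.2 ⟨_, hf ⟨b, hb⟩, i, hi, j, hj, h.1, h.2, hij⟩
      have := hsize b hb
      omega
    rcases h2 with h | h
    · rw [h] at h1; exact h1
    · rw [h] at h1; exact hs.trans h1
end
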